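/- Let a, b, c, d be positive real numbers satisfying c ≤ 1, d ≤ 1, c + d ≤ 1 + a + a·b, and c + d ≤ 1 + b + a·b. Then equality (c+d−1)·(a − a·d + c)/(1+a) + (c+d−1)·(b − b·c + d)/(1+b) = (3/√5 − 1)·(a + b + c + d + a·b) holds if and only if a = b = (√5 − 1)/2 and c = d = 1. -/

import Mathlib

/-- The one-variable inequality on the diagonal, with its equality case. -/
lemma pentagon_diagonal {r k x : ℝ} (hr : r ^ 2 = 5) (hr2 : 2.236 < r) (hr3 : r < 2.237)
    (hk : k = 3 * r / 5 - 1) (hx : 0 ≤ x) (hxg : x ≤ (r - 1) / 2)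
    (h : k * (1 + 2 * x) ≤ x + x ^ 2 - x ^ 3) : x = (r - 1) / 2 := by
  have hfac : k * (1 + 2 * x) - (x + x ^ 2 - x ^ 3) =
      ((r - 1) / 2 - x) * ((3 - r) / 2 * x + (1 - r / 5) - x ^ 2) := by
    subst hk
    linear_combination (x / 4 + 1 / 10) * hr
  have hpos : 0 < (3 - r) / 2 * x + (1 - r / 5) - x ^ 2 := by
    nlinarith [mul_nonneg hx (sub_nonneg.2 hxg)]
  by_contra hne
  have hlt : 0 < (r - 1) / 2 - x := sub_pos.2 (lt_of_le_of_ne hxg hne)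
  linarith [mul_pos hlt hpos]

/-- The equality case once the problem is reduced to `a ≤ b` and `s = c + d - 1`. -/
lemma pentagon_reduced {r k a b s : ℝ} (hr : r ^ 2 = 5) (hr2 : 2.236 < r) (hr3 : r < 2.237)
    (hk : k = 3 * r / 5 - 1) (ha : 0 < a) (hab : a ≤ b) (hs : 0 < s) (hs1 : s ≤ 1)
    (hsa : s ≤ a * (1 + b))
    (h : k * ((1 + a) * (1 + b)) * ((1 + a) * (1 + b) + s) ≤
      s * ((1 + a) * (1 + b)) + s ^ 2 * (1 - a * b)) :
    a = (r - 1) / 2 ∧ b = (r - 1) / 2 ∧ s = 1 := by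
  have hk3 : 1 < 3 * k := by linarith
  -- `x` is the positive root of `x ^ 2 + x = s`
  obtain ⟨x, hx, hxs⟩ : ∃ x : ℝ, 0 < x ∧ x ^ 2 + x = s := by
    have h1 : 1 < √(1 + 4 * s) := Real.lt_sqrt_of_sq_lt (by linarith)
    exact ⟨(√(1 + 4 * s) - 1) / 2, by linarith,
      by linarith [Real.sq_sqrt (show (0 : ℝ) ≤ 1 + 4 * s by linarith)]⟩
  have hxb : x ≤ b := by nlinarith
  have hxg : x ≤ (r - 1) / 2 := by nlinarith
  have hb : 0 < b := by linarith
  have hA : 0 < k * (a * (1 + b) + 2 * s + 2 * (1 + b)) - s + s * s * (b / (1 + b)) := by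
    have : 0 ≤ s * s * (b / (1 + b)) := by positivity
    nlinarith
  have hB : 0 < k * (b + x + 2 + 3 * s) - s + s ^ 3 / ((1 + b) * (1 + x)) := by
    have : 0 ≤ s ^ 3 / ((1 + b) * (1 + x)) := by positivity
    nlinarith
  have hsplit : k * ((1 + a) * (1 + b)) * ((1 + a) * (1 + b) + s) -
        (s * ((1 + a) * (1 + b)) + s ^ 2 * (1 - a * b)) =
      (a * (1 + b) - s) *
          (k * (a * (1 + b) + 2 * s + 2 * (1 + b)) - s + s * s * (b / (1 + b))) +
        (b - x) * (k * (b + x + 2 + 3 * s) - s + s ^ 3 / ((1 + b) * (1 + x))) +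
        (1 + x) ^ 3 * (k * (1 + 2 * x) - (x + x ^ 2 - x ^ 3)) := by
    subst hxs
    field_simp
    ring
  have hA' := mul_nonneg (sub_nonneg.2 hsa) hA.le
  have hB' := mul_nonneg (sub_nonneg.2 hxb) hB.le
  have hxval : x = (r - 1) / 2 := by
    refine pentagon_diagonal hr hr2 hr3 hk hx.le hxg (sub_nonpos.1 ?_)
    exact nonpos_of_mul_nonpos_right (by linarith) (show 0 < (1 + x) ^ 3 by positivity)
  have hzero : k * (1 + 2 * x) - (x + x ^ 2 - x ^ 3) = 0 := by
    subst hk hxval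
    linear_combination (r / 8 - 1 / 40) * hr
  rw [hzero, mul_zero] at hsplit
  have hsab : a * (1 + b) - s = 0 :=
    (mul_eq_zero.1 (le_antisymm (by linarith) hA')).resolve_right hA.ne'
  have hbx : b - x = 0 :=
    (mul_eq_zero.1 (le_antisymm (by linarith) hB')).resolve_right hB.ne'
  have hbx' : b = x := by linarith
  have hax : a = x := by
    have : (a - x) * (1 + x) = 0 := by rw [hbx'] at hsab; linarith
    have := (mul_eq_zero.1 this).resolve_right (by positivity)
    linarith
  exact ⟨hax.trans hxval, hbx'.trans hxval, by rw [← hxs, hxval]; linarith⟩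

/-- Equality in the algebraic core of the pentagon circumscription theorem holds
exactly for the parameters of the affine regular pentagon. -/
theorem pentagon_core_equality (a b c d : ℝ)
    (ha : 0 < a) (hb : 0 < b) (hc : 0 < c) (hd : 0 < d)
    (hc1 : c ≤ 1) (hd1 : d ≤ 1)
    (he : c + d ≤ 1 + a + a * b) (hf : c + d ≤ 1 + b + a * b) :
    (c + d - 1) * (a - a * d + c) / (1 + a) + (c + d - 1) * (b - b * c + d) / (1 + b) =
        (3 / Real.sqrt 5 - 1) * (a + b + c + d + a * b) ↔
      a = (Real.sqrt 5 - 1) / 2 ∧ b = (Real.sqrt 5 - 1) / 2 ∧ c = 1 ∧ d = 1 := by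
  have hr : √5 ^ 2 = (5 : ℝ) := Real.sq_sqrt (by norm_num)
  have hr2 : 2.236 < √5 := Real.lt_sqrt_of_sq_lt (by norm_num)
  have hr3 : √5 < 2.237 := (Real.sqrt_lt' (by norm_num)).2 (by norm_num)
  have hk : 3 / √5 - 1 = 3 * √5 / 5 - 1 := by
    field_simp
    linarith
  set r := √5
  set k := 3 / r - 1
  have hL : (c + d - 1) * (a - a * d + c) / (1 + a) + (c + d - 1) * (b - b * c + d) / (1 + b) =
      ((c + d - 1) * ((1 + a) * (1 + b)) + (c + d - 1) ^ 2 * (1 - a * b)) /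
        ((1 + a) * (1 + b)) := by
    field_simp
    ring
  rw [hL, div_eq_iff (by positivity)]
  constructor
  · intro h
    have hs : 0 < c + d - 1 := by
      by_contra! hs
      have hR : 0 < k * (a + b + c + d + a * b) * ((1 + a) * (1 + b)) := by
        have : 0 < k := by linarith
        positivity
      have h1 : 0 ≤ (1 + a) * (1 + b) + (c + d - 1) * (1 - a * b) := by
        nlinarith [mul_pos ha hb, mul_nonneg (mul_pos ha hb).le (neg_nonneg.2 hs)]
      nlinarith [mul_nonneg (neg_nonneg.2 hs) h1]
    have hval : a = (r - 1) / 2 ∧ b = (r - 1) / 2 ∧ c + d - 1 = 1 := by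
      rcases le_total a b with hab | hab
      · exact pentagon_reduced hr hr2 hr3 hk ha hab hs (by linarith) (by linarith) (by linarith)
      · obtain ⟨hb', ha', hs'⟩ := pentagon_reduced (a := b) (b := a) hr hr2 hr3 hk hb hab hs
          (by linarith) (by linarith) (by linarith)
        exact ⟨ha', hb', hs'⟩
    exact ⟨hval.1, hval.2.1, by linarith [hval.2.2], by linarith [hval.2.2]⟩
  · rintro ⟨rfl, rfl, rfl, rfl⟩
    rw [hk]
    linear_combination (-(3 / 80) * r ^ 3 - 7 / 80 * r ^ 2 - 5 / 16 * r - 21 / 80) * hr
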